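/- With the partition Ω_LEFT = C_G, Ω_MIDDLE = C_FL ∪ (C_AFL ∩ C_R), and Ω_RIGHT = C_R \ C_AFL, no single move of the Glauber dynamics M_G connects a state in Ω_LEFT to a state in Ω_RIGHT: every transition of M_G starting from a state in C_G leads to a state in C_G ∪ C_FL ∪ (C_AFL ∩ C_R). -/

import Mathlib

open Finset

/-! Six-vertex model on the `n × n` square lattice region `Λ_n` with free
boundary conditions.

`Edge.horiz k j` is the horizontal edge between `x = k-1` and `x = k` at
height `j`; `Edge.vert i k` is the vertical edge between `y = k-1` and
`y = k` on column `i`.  The vertices of `Λ_n` are the pairs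
`(i, j) : Fin n × Fin n`.  An edge configuration assigns `true`
(rightwards / upwards) or `false` (leftwards / downwards) to every edge. -/
inductive Edge (n : ℕ) : Type
  | horiz (k : Fin (n + 1)) (j : Fin n) : Edge n
  | vert (i : Fin n) (k : Fin (n + 1)) : Edge n
  deriving DecidableEq, Fintype

abbrev EdgeConfig (n : ℕ) := Edge n → Bool

/-- The four edges incident to the vertex `(i, j)` of `Λ_n`. -/
def leftE {n : ℕ} (i j : Fin n) : Edge n := Edge.horiz i.castSucc j
def rightE {n : ℕ} (i j : Fin n) : Edge n := Edge.horiz i.succ j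
def botE {n : ℕ} (i j : Fin n) : Edge n := Edge.vert i j.castSucc
def topE {n : ℕ} (i j : Fin n) : Edge n := Edge.vert i j.succ

/-- The in-degree of the vertex `(i, j)` in the configuration `τ`. -/
def inDegree {n : ℕ} (τ : EdgeConfig n) (i j : Fin n) : ℕ :=
  (cond (τ (leftE i j)) 1 0) + (cond (τ (rightE i j)) 0 1) +
    (cond (τ (botE i j)) 1 0) + (cond (τ (topE i j)) 0 1)

/-- The ice rule: every vertex has exactly two incoming (and hence two
outgoing) incident edges; such a configuration is an Eulerian orientation. -/
def IceRule {n : ℕ} (τ : EdgeConfig n) : Prop :=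
  ∀ i j : Fin n, inDegree τ i j = 2

instance {n : ℕ} (τ : EdgeConfig n) : Decidable (IceRule τ) :=
  inferInstanceAs (Decidable (∀ i j : Fin n, inDegree τ i j = 2))

/-- `Ω`, the state space: all Eulerian orientations of `Λ_n`. -/
def OmegaSet (n : ℕ) : Set (EdgeConfig n) := {τ | IceRule τ}

/-- The state `τ_G`, in which every vertex has six-vertex type `c`. -/
def greenOrient {n : ℕ} : Edge n → Bool
  | Edge.horiz k j => (k.val + j.val) % 2 == 0
  | Edge.vert i k => (i.val + k.val) % 2 == 1

def tauG (n : ℕ) : EdgeConfig n := greenOrient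

/-- The state `τ_R`, the total edge reversal of `τ_G`. -/
def tauR (n : ℕ) : EdgeConfig n := fun e => !(greenOrient e)

/-- An edge is green in `τ` if it is oriented as in `τ_G`, red otherwise. -/
def greenB {n : ℕ} (τ : EdgeConfig n) (e : Edge n) : Bool := τ e == greenOrient e

def IsGreen {n : ℕ} (τ : EdgeConfig n) (e : Edge n) : Prop := τ e = greenOrient e
def IsRed {n : ℕ} (τ : EdgeConfig n) (e : Edge n) : Prop := τ e = !(greenOrient e)

/-- Incidence between edges and vertices of `Λ_n`. -/
def EdgeIncident {n : ℕ} : Edge n → Fin n × Fin n → Prop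
  | Edge.horiz k j', (i, j) => j' = j ∧ (k = i.castSucc ∨ k = i.succ)
  | Edge.vert i' k, (i, j) => i' = i ∧ (k = j.castSucc ∨ k = j.succ)

/-- Two (distinct) edges are adjacent if they share an incident `Λ_n`-vertex. -/
def EdgeAdj {n : ℕ} (e f : Edge n) : Prop :=
  e ≠ f ∧ ∃ v : Fin n × Fin n, EdgeIncident e v ∧ EdgeIncident f v

/-- A simple (self-avoiding) monochromatic path of edges of colour `g`
(`true` = green, `false` = red). -/
def MonoPath {n : ℕ} (τ : EdgeConfig n) (g : Bool) (p : List (Edge n)) : Prop :=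
  p ≠ [] ∧ p.Nodup ∧ List.Chain' EdgeAdj p ∧ ∀ e ∈ p, greenB τ e = g

/-- A horizontal monochromatic bridge: a simple monochromatic path from a
horizontal edge on the left boundary to a horizontal edge on the right
boundary of `Λ_n`. -/
def IsHorizBridge {n : ℕ} (τ : EdgeConfig n) (g : Bool) (p : List (Edge n)) : Prop :=
  MonoPath τ g p ∧ (∃ j, p.head? = some (Edge.horiz 0 j)) ∧
    (∃ j, p.getLast? = some (Edge.horiz (Fin.last n) j))

/-- A vertical monochromatic bridge, from the top boundary to the bottom. -/
def IsVertBridge {n : ℕ} (τ : EdgeConfig n) (g : Bool) (p : List (Edge n)) : Prop :=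
  MonoPath τ g p ∧ (∃ i, p.head? = some (Edge.vert i (Fin.last n))) ∧
    (∃ i, p.getLast? = some (Edge.vert i 0))

def HorizGreenBridge {n : ℕ} (τ : EdgeConfig n) : Prop := ∃ p, IsHorizBridge τ true p
def HorizRedBridge {n : ℕ} (τ : EdgeConfig n) : Prop := ∃ p, IsHorizBridge τ false p
def VertGreenBridge {n : ℕ} (τ : EdgeConfig n) : Prop := ∃ p, IsVertBridge τ true p
def VertRedBridge {n : ℕ} (τ : EdgeConfig n) : Prop := ∃ p, IsVertBridge τ false p

def HasGreenCross {n : ℕ} (τ : EdgeConfig n) : Prop :=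
  HorizGreenBridge τ ∧ VertGreenBridge τ

def HasRedCross {n : ℕ} (τ : EdgeConfig n) : Prop :=
  HorizRedBridge τ ∧ VertRedBridge τ

/-- `C_G`: the states with a green cross. -/
def CG (n : ℕ) : Set (EdgeConfig n) := {τ | IceRule τ ∧ HasGreenCross τ}

/-- `C_R`: the states with a red cross. -/
def CR (n : ℕ) : Set (EdgeConfig n) := {τ | IceRule τ ∧ HasRedCross τ}

/-! The shifted lattice `L = ℤ² + (1/2, 1/2)`, restricted to the region inside
`Λ_n`.  The `L_n`-vertex `(i, j) : Fin (n+1) × Fin (n+1)` represents the point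
`(i - 1/2, j - 1/2)`; its boundary vertices are those with a coordinate equal
to `0` or `n`.  An `L_n`-edge is a diagonal passing through exactly one
`Λ_n`-vertex; it is recorded as that `Λ_n`-vertex together with a Boolean
(`true` for the NE–SW diagonal, `false` for the NW–SE diagonal). -/
abbrev LVertex (n : ℕ) := Fin (n + 1) × Fin (n + 1)

abbrev LEdge (n : ℕ) := (Fin n × Fin n) × Bool

/-- The two `L_n`-endpoints of an `L_n`-edge. -/
def lEdgeEnds {n : ℕ} : LEdge n → LVertex n × LVertex n
  | ((i, j), true) => ((i.castSucc, j.castSucc), (i.succ, j.succ))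
  | ((i, j), false) => ((i.succ, j.castSucc), (i.castSucc, j.succ))

/-- The `L_n`-edge `e` joins the `L_n`-vertices `u` and `v`. -/
def StepOnEdge {n : ℕ} (e : LEdge n) (u v : LVertex n) : Prop :=
  lEdgeEnds e = (u, v) ∨ lEdgeEnds e = (v, u)

/-- Adjacency in the lattice `L_n`. -/
def LAdjacent {n : ℕ} (u v : LVertex n) : Prop :=
  ∃ e : LEdge n, StepOnEdge e u v

/-- Membership of an `L_n`-edge in `L_τ`: the four `Λ_n`-edges incident to the
`Λ_n`-vertex it passes through are two green and two red, and the edge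
separates the two green edges from the two red ones. -/
def lTau {n : ℕ} (τ : EdgeConfig n) : LEdge n → Bool
  | ((i, j), true) =>
      (greenB τ (leftE i j) == greenB τ (topE i j)) &&
        (greenB τ (rightE i j) == greenB τ (botE i j)) &&
        !(greenB τ (leftE i j) == greenB τ (rightE i j))
  | ((i, j), false) =>
      (greenB τ (leftE i j) == greenB τ (botE i j)) &&
        (greenB τ (rightE i j) == greenB τ (topE i j)) &&
        !(greenB τ (leftE i j) == greenB τ (rightE i j))

/-- A step between two `L_n`-vertices along an edge of `L_τ`. -/
def LStep {n : ℕ} (τ : EdgeConfig n) (u v : LVertex n) : Prop :=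
  ∃ e : LEdge n, StepOnEdge e u v ∧ lTau τ e = true

/-- The consecutive steps of a path given as a list of vertices. -/
def pathSteps {α : Type*} (p : List α) : List (α × α) := p.zip p.tail

/-- A vertical fault line: a self-avoiding path of `L_τ`-edges from an
`L_n`-vertex on the top boundary to an `L_n`-vertex on the bottom boundary. -/
def IsVertFaultLine {n : ℕ} (τ : EdgeConfig n) (p : List (LVertex n)) : Prop :=
  p ≠ [] ∧ p.Nodup ∧ List.Chain' (LStep τ) p ∧
    (∃ u, p.head? = some u ∧ u.2 = Fin.last n) ∧
    (∃ u, p.getLast? = some u ∧ u.2 = 0)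

/-- A horizontal fault line: from the left boundary to the right boundary. -/
def IsHorizFaultLine {n : ℕ} (τ : EdgeConfig n) (p : List (LVertex n)) : Prop :=
  p ≠ [] ∧ p.Nodup ∧ List.Chain' (LStep τ) p ∧
    (∃ u, p.head? = some u ∧ u.1 = 0) ∧
    (∃ u, p.getLast? = some u ∧ u.1 = Fin.last n)

def HasVertFaultLine {n : ℕ} (τ : EdgeConfig n) : Prop := ∃ p, IsVertFaultLine τ p
def HasHorizFaultLine {n : ℕ} (τ : EdgeConfig n) : Prop := ∃ p, IsHorizFaultLine τ p

/-- `C_FL`: the states with a (horizontal or vertical) fault line. -/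
def CFL (n : ℕ) : Set (EdgeConfig n) :=
  {τ | IceRule τ ∧ (HasHorizFaultLine τ ∨ HasVertFaultLine τ)}

/-- A vertical almost fault line: a self-avoiding `L_n`-path from the top
boundary to the bottom boundary all of whose edges except exactly one
belong to `L_τ`. -/
def IsVertAlmostFaultLine {n : ℕ} (τ : EdgeConfig n) (p : List (LVertex n)) : Prop :=
  p ≠ [] ∧ p.Nodup ∧ List.Chain' LAdjacent p ∧
    (∃ u, p.head? = some u ∧ u.2 = Fin.last n) ∧
    (∃ u, p.getLast? = some u ∧ u.2 = 0) ∧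
    ∃ s ∈ pathSteps p, ¬ LStep τ s.1 s.2 ∧
      ∀ t ∈ pathSteps p, t ≠ s → LStep τ t.1 t.2

/-- A horizontal almost fault line. -/
def IsHorizAlmostFaultLine {n : ℕ} (τ : EdgeConfig n) (p : List (LVertex n)) : Prop :=
  p ≠ [] ∧ p.Nodup ∧ List.Chain' LAdjacent p ∧
    (∃ u, p.head? = some u ∧ u.1 = 0) ∧
    (∃ u, p.getLast? = some u ∧ u.1 = Fin.last n) ∧
    ∃ s ∈ pathSteps p, ¬ LStep τ s.1 s.2 ∧
      ∀ t ∈ pathSteps p, t ≠ s → LStep τ t.1 t.2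

/-- `C_AFL`: the states with an almost fault line. -/
def CAFL (n : ℕ) : Set (EdgeConfig n) :=
  {τ | IceRule τ ∧
    ((∃ p, IsHorizAlmostFaultLine τ p) ∨ (∃ p, IsVertAlmostFaultLine τ p))}

/-- The weight of the vertex `(i, j)`: `c` for the two `c`-type configurations
(both horizontal edges in, or both out), and `a` or `b` for the others. -/
noncomputable def vertexWeight {n : ℕ} (a b c : ℝ) (τ : EdgeConfig n)
    (i j : Fin n) : ℝ :=
  if τ (leftE i j) ≠ τ (rightE i j) then c
  else if τ (leftE i j) = τ (botE i j) then a else b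

/-- The weight `w(τ)` of a state: the product of the vertex weights. -/
noncomputable def weight {n : ℕ} (a b c : ℝ) (τ : EdgeConfig n) : ℝ :=
  ∏ v : Fin n × Fin n, vertexWeight a b c τ v.1 v.2

/-- The partition function `Z`. -/
noncomputable def Zsum (n : ℕ) (a b c : ℝ) : ℝ :=
  ∑ τ ∈ Finset.univ.filter (fun τ : EdgeConfig n => IceRule τ), weight a b c τ

open Classical in
/-- The Gibbs measure of a set of states, `π(S) = (Σ_{τ∈S} w(τ))/Z`. -/
noncomputable def piSet (n : ℕ) (a b c : ℝ) (S : Set (EdgeConfig n)) : ℝ :=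
  (∑ τ ∈ Finset.univ.filter (fun τ : EdgeConfig n => τ ∈ S), weight a b c τ) /
    Zsum n a b c

/-- The four edges (bottom, right, top, left) of the unit square of `ℤ²`
whose lower-left corner is the `Λ_n`-vertex `(i, j)`. -/
def squareEdges (n : ℕ) (i j : ℕ) (hi : i + 1 < n) (hj : j + 1 < n) :
    Edge n × Edge n × Edge n × Edge n :=
  (Edge.horiz ⟨i + 1, by omega⟩ ⟨j, by omega⟩,
    Edge.vert ⟨i + 1, by omega⟩ ⟨j + 1, by omega⟩,
    Edge.horiz ⟨i + 1, by omega⟩ ⟨j + 1, by omega⟩,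
    Edge.vert ⟨i, by omega⟩ ⟨j + 1, by omega⟩)

/-- The four edges (bottom, right, top, left) around a unit square form a
directed cycle, i.e. are consistently oriented. -/
def DirectedSquare {n : ℕ} (τ : EdgeConfig n)
    (e : Edge n × Edge n × Edge n × Edge n) : Prop :=
  (τ e.1 = true ∧ τ e.2.1 = true ∧ τ e.2.2.1 = false ∧ τ e.2.2.2 = false) ∨
    (τ e.1 = false ∧ τ e.2.1 = false ∧ τ e.2.2.1 = true ∧ τ e.2.2.2 = true)

/-- Reversing the orientations of the four edges around a unit square. -/
def flipSquare {n : ℕ} (τ : EdgeConfig n)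
    (e : Edge n × Edge n × Edge n × Edge n) : EdgeConfig n :=
  fun f => if f = e.1 ∨ f = e.2.1 ∨ f = e.2.2.1 ∨ f = e.2.2.2 then !(τ f) else τ f

/-- A move of the Glauber dynamics `M_G` at the unit square with lower-left
corner `(i, j)`: the four edges around the square are consistently oriented
in `τ`, and `τ'` is obtained from `τ` by reversing them. -/
def GlauberMoveAt {n : ℕ} (τ τ' : EdgeConfig n) (i j : ℕ)
    (hi : i + 1 < n) (hj : j + 1 < n) : Prop :=
  DirectedSquare τ (squareEdges n i j hi hj) ∧
    τ' = flipSquare τ (squareEdges n i j hi hj)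

/-- A move of the Glauber dynamics `M_G`. -/
def GlauberMove {n : ℕ} (τ τ' : EdgeConfig n) : Prop :=
  ∃ (i j : ℕ) (hi : i + 1 < n) (hj : j + 1 < n), GlauberMoveAt τ τ' i j hi hj

/-- `∂C_G`: the states outside `C_G` that are one move of `M_G` away from
`C_G`. -/
def boundaryCG (n : ℕ) : Set (EdgeConfig n) :=
  {τ | IceRule τ ∧ τ ∉ CG n ∧ ∃ σ ∈ CG n, GlauberMove σ τ}

/-- The state space `Ω` as a type. -/
abbrev OmegaT (n : ℕ) := {τ : EdgeConfig n // IceRule τ}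

open Classical in
/-- Metropolis transition rate of `M_G` between two distinct states: propose
one of the `(n-1)²` unit squares uniformly at random and accept the flip with
probability `min 1 (w(τ')/w(τ))`. -/
noncomputable def metro {n : ℕ} (a b c : ℝ) (τ τ' : OmegaT n) : ℝ :=
  if GlauberMove τ.1 τ'.1 then
    (1 / (((n : ℝ) - 1) * ((n : ℝ) - 1))) *
      min 1 (weight a b c τ'.1 / weight a b c τ.1)
  else 0

/-- The transition matrix of the Glauber dynamics `M_G`. -/
noncomputable def transP {n : ℕ} (a b c : ℝ) (τ τ' : OmegaT n) : ℝ :=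
  if τ' = τ then 1 - ∑ σ ∈ Finset.univ.erase τ, metro a b c τ σ
  else metro a b c τ τ'

/-- The `t`-step transition probabilities of `M_G`. -/
noncomputable def transPow {n : ℕ} (a b c : ℝ) : ℕ → OmegaT n → OmegaT n → ℝ
  | 0, τ, τ' => if τ = τ' then 1 else 0
  | t + 1, τ, τ' => ∑ σ : OmegaT n, transPow a b c t τ σ * transP a b c σ τ'

/-- The stationary Gibbs distribution `π` on `Ω`. -/
noncomputable def piDist {n : ℕ} (a b c : ℝ) (τ : OmegaT n) : ℝ :=
  weight a b c τ.1 / Zsum n a b c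

/-- Total variation distance between two distributions on `Ω`. -/
noncomputable def tvDist {n : ℕ} (μ ν : OmegaT n → ℝ) : ℝ :=
  (∑ τ : OmegaT n, |μ τ - ν τ|) / 2

/-- The mixing time of `M_G`: the smallest `t` after which the total variation
distance to `π` is at most `1/4` from any starting state. -/
noncomputable def mixingTime (n : ℕ) (a b c : ℝ) : ℕ :=
  sInf {t : ℕ | ∀ τ₀ : OmegaT n,
    tvDist (transPow a b c t τ₀) (piDist a b c) ≤ 1 / 4}

/-- The number of green edges incident to the vertex `(i, j)` in `τ`. -/
def greenCountAt {n : ℕ} (τ : EdgeConfig n) (i j : Fin n) : ℕ :=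
  (cond (greenB τ (leftE i j)) 1 0) + (cond (greenB τ (rightE i j)) 1 0) +
    (cond (greenB τ (botE i j)) 1 0) + (cond (greenB τ (topE i j)) 1 0)

/-- The number of `L_τ`-edges incident to the `L_n`-vertex `u`. -/
def lTauDegree {n : ℕ} (τ : EdgeConfig n) (u : LVertex n) : ℕ :=
  (Finset.univ.filter (fun e : LEdge n =>
    lTau τ e = true ∧ ((lEdgeEnds e).1 = u ∨ (lEdgeEnds e).2 = u))).card

/-- The number of colour changes encountered when going rotationally
(bottom, right, top, left) around the four `Λ_n`-edges surrounding the
internal `L_n`-vertex `(i, j)` (representing the point `(i - 1/2, j - 1/2)`). -/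
def colorChangesAround (n : ℕ) (τ : EdgeConfig n) (i j : ℕ)
    (hi0 : 0 < i) (hin : i < n) (hj0 : 0 < j) (hjn : j < n) : ℕ :=
  let bo := greenB τ (Edge.horiz ⟨i, by omega⟩ ⟨j - 1, by omega⟩)
  let t := greenB τ (Edge.horiz ⟨i, by omega⟩ ⟨j, by omega⟩)
  let l := greenB τ (Edge.vert ⟨i - 1, by omega⟩ ⟨j, by omega⟩)
  let r := greenB τ (Edge.vert ⟨i, by omega⟩ ⟨j, by omega⟩)
  (cond (bo != r) 1 0) + (cond (r != t) 1 0) +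
    (cond (t != l) 1 0) + (cond (l != bo) 1 0)

/-- The total of `c` over the horizontal edges of column `k` below the face `(k, m)`. -/
def columnSum {n : ℕ} (c : Edge n → ZMod 2) (k m : Fin (n + 1)) : ZMod 2 :=
  Fin.partialSum (fun j => c (Edge.horiz k j)) m

/-- The mod-2 flux of a chain of edges at the vertex `v`. -/
def edgeFlux {n : ℕ} (c : Edge n → ZMod 2) (v : Fin n × Fin n) : ZMod 2 :=
  c (leftE v.1 v.2) + c (rightE v.1 v.2) + c (botE v.1 v.2) + c (topE v.1 v.2)

/-- The mod-2 coboundary of a function on the faces. -/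
def faceDiff {n : ℕ} (h : LVertex n → ZMod 2) : Edge n → ZMod 2
  | Edge.horiz k j => h (k, j.castSucc) + h (k, j.succ)
  | Edge.vert i k => h (i.castSucc, k) + h (i.succ, k)

/-- The edge `e` has colour `b` and avoids `W`. -/
def GoodEdge {n : ℕ} (τ : EdgeConfig n) (b : Bool) (W : Set (Edge n)) (e : Edge n) : Prop :=
  greenB τ e = b ∧ e ∉ W

/-- Two edges of colour `b` avoiding `W` share a vertex. -/
def Hop {n : ℕ} (τ : EdgeConfig n) (b : Bool) (W : Set (Edge n)) (e f : Edge n) : Prop :=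
  (∃ v, EdgeIncident e v ∧ EdgeIncident f v) ∧ GoodEdge τ b W e ∧ GoodEdge τ b W f

/-- `e` is connected to the left boundary by edges of colour `b` avoiding `W`. -/
def LeftConn {n : ℕ} (τ : EdgeConfig n) (b : Bool) (W : Set (Edge n)) (e : Edge n) : Prop :=
  ∃ j, GoodEdge τ b W (Edge.horiz 0 j) ∧ Relation.ReflTransGen (Hop τ b W) (Edge.horiz 0 j) e

/-- The left and right boundaries are connected by edges of colour `b` avoiding `W`. -/
def HorizConn {n : ℕ} (τ : EdgeConfig n) (b : Bool) (W : Set (Edge n)) : Prop :=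
  ∃ j, LeftConn τ b W (Edge.horiz (Fin.last n) j)

lemma goodEdge_of_leftConn {n : ℕ} {τ : EdgeConfig n} {b : Bool} {W : Set (Edge n)} {e : Edge n}
    (h : LeftConn τ b W e) : GoodEdge τ b W e := by
  obtain ⟨j, hj, hr⟩ := h
  rcases Relation.ReflTransGen.cases_tail hr with rfl | ⟨f, -, hf⟩
  exacts [hj, hf.2.2]

lemma edgeIncident_iff {n : ℕ} {v : Fin n × Fin n} {e : Edge n} :
    EdgeIncident e v ↔ e = leftE v.1 v.2 ∨ e = rightE v.1 v.2 ∨ e = botE v.1 v.2 ∨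
      e = topE v.1 v.2 := by
  obtain ⟨i, j⟩ := v
  cases e <;> simp [EdgeIncident, leftE, rightE, botE, topE] <;> grind

/-- The ice rule in terms of colours. -/
lemma inDegree_eq_two_iff {n : ℕ} {τ : EdgeConfig n} {i j : Fin n} :
    inDegree τ i j = 2 ↔
    ((greenB τ (leftE i j) = greenB τ (topE i j) ∧
        greenB τ (rightE i j) = greenB τ (botE i j)) ∨
      (greenB τ (leftE i j) = greenB τ (botE i j) ∧
        greenB τ (rightE i j) = greenB τ (topE i j))) := by
  have hpar : ∀ m : ℕ, m % 2 = 0 ∨ m % 2 = 1 := fun m => Nat.mod_two_eq_zero_or_one m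
  simp only [inDegree, greenB, leftE, rightE, botE, topE, greenOrient, Fin.val_succ,
    Fin.val_castSucc]
  have h1 : (i.val + 1 + j.val) % 2 = (i.val + j.val + 1) % 2 := by congr 1; omega
  have h2 : (i.val + (j.val + 1)) % 2 = (i.val + j.val + 1) % 2 := by congr 1
  rw [h1, h2]
  rcases hpar (i.val + j.val) with h | h
  · have h' : (i.val + j.val + 1) % 2 = 1 := by omega
    rw [h, h']
    cases τ (Edge.horiz i.castSucc j) <;> cases τ (Edge.horiz i.succ j) <;>
      cases τ (Edge.vert i j.castSucc) <;> cases τ (Edge.vert i j.succ) <;> decide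
  · have h' : (i.val + j.val + 1) % 2 = 0 := by omega
    rw [h, h']
    cases τ (Edge.horiz i.castSucc j) <;> cases τ (Edge.horiz i.succ j) <;>
      cases τ (Edge.vert i j.castSucc) <;> cases τ (Edge.vert i j.succ) <;> decide

lemma columnSum_add_columnSum {n : ℕ} {c : Edge n → ZMod 2} (hc : ∀ v, edgeFlux c v = 0)
    (hbot : ∀ i, c (Edge.vert i 0) = 0) (i : Fin n) (m : Fin (n + 1)) :
    columnSum c i.castSucc m + columnSum c i.succ m = c (Edge.vert i m) := by
  induction m using Fin.induction with
  | zero => simp [columnSum, hbot]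
  | succ j ih =>
    have h := hc (i, j)
    simp only [columnSum, edgeFlux, leftE, rightE, botE, topE, Fin.partialSum_succ] at h ih ⊢
    rw [← ih] at h
    linear_combination h + (- c (Edge.vert i j.succ)) * (CharTwo.two_eq_zero (R := ZMod 2))

/-- The flux of a closed chain through the columns is constant. -/
lemma columnSum_last_eq {n : ℕ} {c : Edge n → ZMod 2} (hc : ∀ v, edgeFlux c v = 0)
    (hbot : ∀ i, c (Edge.vert i 0) = 0) (htop : ∀ i, c (Edge.vert i (Fin.last n)) = 0)
    (k : Fin (n + 1)) : columnSum c k (Fin.last n) = columnSum c 0 (Fin.last n) := by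
  induction k using Fin.induction with
  | zero => rfl
  | succ i ih =>
    have h := columnSum_add_columnSum hc hbot i (Fin.last n)
    rw [htop, CharTwo.add_eq_zero] at h
    rw [← h, ih]

lemma columnSum_congr {n : ℕ} {c d : Edge n → ZMod 2} {k : Fin (n + 1)}
    (h : ∀ j, c (Edge.horiz k j) = d (Edge.horiz k j)) (m : Fin (n + 1)) :
    columnSum c k m = columnSum d k m := by
  simp only [columnSum, h]

lemma columnSum_add {n : ℕ} (c d : Edge n → ZMod 2) (k m : Fin (n + 1)) :
    columnSum (c + d) k m = columnSum c k m + columnSum d k m := by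
  induction m using Fin.induction with
  | zero => simp [columnSum]
  | succ j ih =>
    simp only [columnSum, Fin.partialSum_succ, Pi.add_apply] at ih ⊢
    rw [ih]; ring

lemma columnSum_zero {n : ℕ} (k m : Fin (n + 1)) : columnSum (0 : Edge n → ZMod 2) k m = 0 := by
  have h := columnSum_add (0 : Edge n → ZMod 2) 0 k m
  simpa using h

lemma columnSum_faceDiff {n : ℕ} (h : LVertex n → ZMod 2) (k m : Fin (n + 1)) :
    columnSum (faceDiff h) k m = h (k, 0) + h (k, m) := by
  induction m using Fin.induction with
  | zero => simp [columnSum, CharTwo.add_self_eq_zero]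
  | succ j ih =>
    simp only [columnSum, Fin.partialSum_succ, faceDiff] at ih ⊢
    rw [ih]
    linear_combination h (k, j.castSucc) * (CharTwo.two_eq_zero (R := ZMod 2))

/-- A function on the faces that is constant along `L_τ` and across the edges of `W`, and
separates the top from the bottom, forces a monochromatic horizontal connection avoiding `W`. -/
lemma exists_horizConn {n : ℕ} {τ : EdgeConfig n} (hτ : IceRule τ) (W : Set (Edge n))
    (h : LVertex n → ZMod 2) (x : ZMod 2) (htop : ∀ k, h (k, Fin.last n) = x + 1)
    (hbot : ∀ k, h (k, 0) = x)
    (hL : ∀ e, lTau τ e = true → h (lEdgeEnds e).1 = h (lEdgeEnds e).2)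
    (hW : ∀ e ∈ W, faceDiff h e = 0) : ∃ b, HorizConn τ b W := by
  classical
  by_contra! hno
  let cc : Bool → Edge n → ZMod 2 := fun b e => if greenB τ e = b then faceDiff h e else 0
  have hclosed : ∀ b v, edgeFlux (cc b) v = 0 := by
    rintro b ⟨i, j⟩
    have hice := inDegree_eq_two_iff.1 (hτ i j)
    have h1 := hL ((i, j), true)
    have h2 := hL ((i, j), false)
    simp only [lTau, lEdgeEnds] at h1 h2
    simp only [edgeFlux, cc]
    have e1 : faceDiff h (leftE i j) = h (i.castSucc, j.castSucc) + h (i.castSucc, j.succ) := rfl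
    have e2 : faceDiff h (rightE i j) = h (i.succ, j.castSucc) + h (i.succ, j.succ) := rfl
    have e3 : faceDiff h (botE i j) = h (i.castSucc, j.castSucc) + h (i.succ, j.castSucc) := rfl
    have e4 : faceDiff h (topE i j) = h (i.castSucc, j.succ) + h (i.succ, j.succ) := rfl
    rw [e1, e2, e3, e4]
    generalize h (i.castSucc, j.castSucc) = p at *
    generalize h (i.castSucc, j.succ) = q at *
    generalize h (i.succ, j.castSucc) = r at *
    generalize h (i.succ, j.succ) = s at *
    generalize greenB τ (leftE i j) = u1 at *
    generalize greenB τ (rightE i j) = u2 at *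
    generalize greenB τ (botE i j) = u3 at *
    generalize greenB τ (topE i j) = u4 at *
    clear e1 e2 e3 e4
    revert p q r s
    cases u1 <;> cases u2 <;> cases u3 <;> cases u4 <;> cases b <;>
      first | (exfalso; revert hice; decide) | decide
  let ck : Bool → Edge n → ZMod 2 := fun b e => if LeftConn τ b W e then cc b e else 0
  have hgood : ∀ b e, cc b e ≠ 0 → GoodEdge τ b W e := by
    intro b e he
    simp only [cc] at he
    split_ifs at he with hg
    exacts [⟨hg, fun hw => he (hW e hw)⟩, absurd rfl he]
  have hkclosed : ∀ b v, edgeFlux (ck b) v = 0 := by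
    intro b v
    by_cases hv : ∃ e, EdgeIncident e v ∧ LeftConn τ b W e
    · obtain ⟨e, hev, he⟩ := hv
      have key : ∀ f, EdgeIncident f v → ck b f = cc b f := by
        intro f hf
        simp only [ck]
        split_ifs with hk
        · rfl
        · by_contra hne
          obtain ⟨j, hj, hr⟩ := he
          exact hk
            ⟨j, hj, hr.tail ⟨⟨v, hev, hf⟩, goodEdge_of_leftConn ⟨j, hj, hr⟩, hgood b f (Ne.symm hne)⟩⟩
      rw [← hclosed b v]
      simp only [edgeFlux]
      rw [key _ (edgeIncident_iff.2 (by simp)), key _ (edgeIncident_iff.2 (by simp)),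
        key _ (edgeIncident_iff.2 (by simp)), key _ (edgeIncident_iff.2 (by simp))]
    · push Not at hv
      have key : ∀ f, EdgeIncident f v → ck b f = 0 := fun f hf => if_neg (hv f hf)
      simp only [edgeFlux]
      rw [key _ (edgeIncident_iff.2 (by simp)), key _ (edgeIncident_iff.2 (by simp)),
        key _ (edgeIncident_iff.2 (by simp)), key _ (edgeIncident_iff.2 (by simp))]
      simp
  have hzero : ∀ b, columnSum (cc b) 0 (Fin.last n) = 0 := by
    intro b
    have hb : ∀ i, ck b (Edge.vert i 0) = 0 := by
      intro i
      simp [ck, cc, faceDiff, hbot, CharTwo.add_self_eq_zero]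
    have ht : ∀ i, ck b (Edge.vert i (Fin.last n)) = 0 := by
      intro i
      simp [ck, cc, faceDiff, htop, CharTwo.add_self_eq_zero]
    have h0 : columnSum (ck b) (Fin.last n) (Fin.last n) = 0 := by
      rw [columnSum_congr (d := 0), columnSum_zero]
      intro j
      exact if_neg fun hj => hno b ⟨j, hj⟩
    rw [columnSum_last_eq (hkclosed b) hb ht] at h0
    rw [← h0]
    apply columnSum_congr
    intro j
    simp only [ck]
    split_ifs with hk
    · rfl
    · by_contra hne
      exact hk ⟨j, hgood b _ hne, .refl⟩
  have hsum : faceDiff h = cc true + cc false := by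
    funext e
    simp only [cc, Pi.add_apply]
    cases greenB τ e <;> simp
  have := columnSum_faceDiff h 0 (Fin.last n)
  rw [hsum, columnSum_add, hzero, hzero, hbot, htop, ← add_assoc,
    CharTwo.add_self_eq_zero] at this
  clear * - this
  revert x
  decide

/-- Reflection of the edges in the main diagonal. -/
def Edge.swap {n : ℕ} : Edge n → Edge n
  | Edge.horiz k j => Edge.vert j k
  | Edge.vert i k => Edge.horiz k i

/-- Reflection of a configuration in the main diagonal, preserving the colours. -/
def transposeConfig {n : ℕ} (τ : EdgeConfig n) : EdgeConfig n := fun e => !τ e.swap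

lemma Edge.swap_swap {n : ℕ} (e : Edge n) : e.swap.swap = e := by
  cases e <;> rfl

lemma greenB_transposeConfig {n : ℕ} (τ : EdgeConfig n) (e : Edge n) :
    greenB (transposeConfig τ) e = greenB τ e.swap := by
  cases e with
  | horiz k j =>
    simp only [greenB, transposeConfig, Edge.swap, greenOrient, add_comm k.val]
    rcases Nat.mod_two_eq_zero_or_one (j.val + k.val) with h | h <;> rw [h] <;>
      cases τ (Edge.vert j k) <;> rfl
  | vert k j =>
    simp only [greenB, transposeConfig, Edge.swap, greenOrient, add_comm k.val]
    rcases Nat.mod_two_eq_zero_or_one (j.val + k.val) with h | h <;> rw [h] <;>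
      cases τ (Edge.horiz j k) <;> rfl

lemma transposeConfig_transposeConfig {n : ℕ} (τ : EdgeConfig n) :
    transposeConfig (transposeConfig τ) = τ := by
  funext e
  simp [transposeConfig, Edge.swap_swap]

lemma iceRule_transposeConfig {n : ℕ} {τ : EdgeConfig n} (hτ : IceRule τ) :
    IceRule (transposeConfig τ) := by
  intro i j
  have h := inDegree_eq_two_iff.1 (hτ j i)
  rw [inDegree_eq_two_iff]
  simp only [greenB_transposeConfig]
  change (greenB τ (botE j i) = greenB τ (rightE j i) ∧ greenB τ (topE j i) = greenB τ (leftE j i))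
    ∨ (greenB τ (botE j i) = greenB τ (leftE j i) ∧ greenB τ (topE j i) = greenB τ (rightE j i))
  tauto

lemma edgeIncident_swap {n : ℕ} {v : Fin n × Fin n} {e : Edge n} (h : EdgeIncident e v) :
    EdgeIncident e.swap v.swap := by
  obtain ⟨i, j⟩ := v
  cases e <;> exact h

lemma hop_symm {n : ℕ} {τ : EdgeConfig n} {b : Bool} {W : Set (Edge n)} {e f : Edge n}
    (h : Hop τ b W e f) : Hop τ b W f e := by
  obtain ⟨⟨v, he, hf⟩, h1, h2⟩ := h
  exact ⟨⟨v, hf, he⟩, h2, h1⟩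

lemma reflTransGen_symm {α : Type*} {r : α → α → Prop} (hr : ∀ a b, r a b → r b a) {a b : α}
    (h : Relation.ReflTransGen r a b) : Relation.ReflTransGen r b a := by
  induction h with
  | refl => rfl
  | tail _ h ih => exact ih.head (hr _ _ h)

/-- An edge incident to two distinct vertices is not on the boundary. -/
lemma edgeIncident_interior {n : ℕ} {u v : Fin n × Fin n} {e : Edge n} (hu : EdgeIncident e u)
    (hv : EdgeIncident e v) (huv : u ≠ v) :
    (∀ i, e ≠ Edge.vert i 0) ∧ (∀ i, e ≠ Edge.vert i (Fin.last n)) ∧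
      (∀ j, e ≠ Edge.horiz 0 j) ∧ (∀ j, e ≠ Edge.horiz (Fin.last n) j) := by
  obtain ⟨i, j⟩ := u
  obtain ⟨i', j'⟩ := v
  cases e with
  | horiz k l =>
    obtain ⟨rfl, hu⟩ := hu
    obtain ⟨rfl, hv⟩ := hv
    have hii : i.val ≠ i'.val := fun h => huv (by rw [Fin.ext h])
    refine ⟨by simp, by simp, fun a h => ?_, fun a h => ?_⟩ <;> cases h <;>
      simp [Fin.ext_iff] at hu hv <;> omega
  | vert l k =>
    obtain ⟨rfl, hu⟩ := hu
    obtain ⟨rfl, hv⟩ := hv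
    have hjj : j.val ≠ j'.val := fun h => huv (by rw [Fin.ext h])
    refine ⟨fun a h => ?_, fun a h => ?_, by simp, by simp⟩ <;> cases h <;>
      simp [Fin.ext_iff] at hu hv <;> omega

/-- An edge has at most two endpoints. -/
lemma edgeIncident_eq_or_eq {n : ℕ} {u v w : Fin n × Fin n} {e : Edge n} (hu : EdgeIncident e u)
    (hv : EdgeIncident e v) (hw : EdgeIncident e w) (hvw : v ≠ w) : u = v ∨ u = w := by
  obtain ⟨i, j⟩ := u
  obtain ⟨i', j'⟩ := v
  obtain ⟨i'', j''⟩ := w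
  cases e with
  | horiz k l =>
    obtain ⟨rfl, hu⟩ := hu
    obtain ⟨rfl, hv⟩ := hv
    obtain ⟨rfl, hw⟩ := hw
    have hii : i'.val ≠ i''.val := fun h => hvw (by rw [Fin.ext h])
    simp only [Fin.ext_iff, Fin.val_castSucc, Fin.val_succ, Prod.mk.injEq, and_true] at hu hv hw ⊢
    omega
  | vert l k =>
    obtain ⟨rfl, hu⟩ := hu
    obtain ⟨rfl, hv⟩ := hv
    obtain ⟨rfl, hw⟩ := hw
    have hjj : j'.val ≠ j''.val := fun h => hvw (by rw [Fin.ext h])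
    simp only [Fin.ext_iff, Fin.val_castSucc, Fin.val_succ, Prod.mk.injEq, true_and] at hu hv hw ⊢
    omega

/-- The flux of the chain of a single edge with endpoint `v`. -/
lemma edgeFlux_single {n : ℕ} (e : Edge n) (v : Fin n × Fin n) [Decidable (EdgeIncident e v)] :
    edgeFlux (Pi.single e 1) v = if EdgeIncident e v then 1 else 0 := by
  obtain ⟨i, j⟩ := v
  have hi : i.castSucc ≠ i.succ := by simp [Fin.ext_iff]
  have hj : j.castSucc ≠ j.succ := by simp [Fin.ext_iff]
  by_cases h : EdgeIncident e (i, j)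
  · rw [if_pos h]
    rcases edgeIncident_iff.1 h with rfl | rfl | rfl | rfl <;>
      simp [edgeFlux, leftE, rightE, botE, topE, hi, hi.symm, hj, hj.symm]
  · rw [if_neg h]
    rw [edgeIncident_iff] at h
    push Not at h
    simp [edgeFlux, h.1.symm, h.2.1.symm, h.2.2.1.symm, h.2.2.2.symm]

lemma edgeFlux_add {n : ℕ} (c d : Edge n → ZMod 2) (v : Fin n × Fin n) :
    edgeFlux (c + d) v = edgeFlux c v + edgeFlux d v := by
  simp only [edgeFlux, Pi.add_apply]; ring

lemma columnSum_single {n : ℕ} (j : Fin n) :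
    columnSum (Pi.single (Edge.horiz 0 j) 1) 0 (Fin.last n) = 1 := by
  have key : ∀ m : Fin (n + 1), columnSum (Pi.single (Edge.horiz 0 j) 1) 0 m =
      if j.castSucc < m then 1 else 0 := by
    intro m
    induction m using Fin.induction with
    | zero => simp [columnSum]
    | succ i ih =>
      simp only [columnSum, Fin.partialSum_succ] at ih ⊢
      rw [ih]
      simp only [Pi.single_apply, Edge.horiz.injEq, true_and]
      rcases lt_trichotomy j i with h | h | h
      · simp [h, h.le, h.ne', Fin.castSucc_lt_succ_iff]
      · simp [h]
      · simp [h.not_gt, h.not_ge, h.ne, Fin.castSucc_lt_succ_iff]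
  rw [key, if_pos (Fin.castSucc_lt_last j)]

lemma exists_edgeIncident {n : ℕ} (e : Edge n) : ∃ v, EdgeIncident e v := by
  cases e with
  | horiz k j =>
    have := j.isLt
    by_cases hk : k.val = 0
    · exact ⟨(⟨0, by omega⟩, j), rfl, Or.inl (by ext; simpa using hk)⟩
    · exact ⟨(⟨k - 1, by omega⟩, j), rfl, Or.inr (by ext; simp; omega)⟩
  | vert i k =>
    have := i.isLt
    by_cases hk : k.val = 0
    · exact ⟨(i, ⟨0, by omega⟩), rfl, Or.inl (by ext; simpa using hk)⟩
    · exact ⟨(i, ⟨k - 1, by omega⟩), rfl, Or.inr (by ext; simp; omega)⟩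

/-- A connection to the left boundary carries a unit of flux. -/
lemma exists_chain_of_leftConn {n : ℕ} {τ : EdgeConfig n} {b : Bool} {e : Edge n}
    (h : LeftConn τ b ∅ e) (v : Fin n × Fin n) (hv : EdgeIncident e v) :
    ∃ c : Edge n → ZMod 2, (∀ f, c f ≠ 0 → greenB τ f = b) ∧
      (∀ u, edgeFlux c u = if u = v then 1 else 0) ∧ (∀ i, c (Edge.vert i 0) = 0) ∧
      (∀ i, c (Edge.vert i (Fin.last n)) = 0) ∧ (∀ j, c (Edge.horiz (Fin.last n) j) = 0) ∧
      columnSum c 0 (Fin.last n) = 1 := by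
  classical
  obtain ⟨j, hj, hr⟩ := h
  induction hr generalizing v with
  | refl =>
    obtain ⟨i', j'⟩ := v
    have hn : 0 < n := j.pos
    have hi' : i'.val < n := i'.isLt
    refine ⟨Pi.single (Edge.horiz 0 j) 1, ?_, ?_, ?_, ?_, ?_, columnSum_single j⟩
    · intro f hf
      by_cases hfe : f = Edge.horiz 0 j
      · exact hfe ▸ hj.1
      · simp [hfe] at hf
    · intro u
      rw [edgeFlux_single]
      obtain ⟨i, k⟩ := u
      congr 1
      simp [EdgeIncident, Fin.ext_iff] at hv ⊢
      omega
    · intro i; simp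
    · intro i; simp
    · intro k; simp [Fin.ext_iff, hn.ne']
  | @tail e f _ hhop ih =>
    obtain ⟨⟨w, hew, hfw⟩, -, hf⟩ := hhop
    obtain ⟨c, h1, h2, h3, h4, h5, h6⟩ := ih w hew
    by_cases hvw : v = w
    · exact hvw ▸ ⟨c, h1, h2, h3, h4, h5, h6⟩
    obtain ⟨b1, b2, b3, b4⟩ := edgeIncident_interior hv hfw hvw
    refine ⟨c + Pi.single f 1, ?_, ?_, ?_, ?_, ?_, ?_⟩
    · intro d hd
      by_cases hdf : d = f
      · exact hdf ▸ hf.1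
      · exact h1 d (by simpa [Pi.single_apply, hdf] using hd)
    · intro u
      rw [edgeFlux_add, h2, edgeFlux_single]
      by_cases huv : u = v
      · subst huv; simp [hv, hvw]
      by_cases huw : u = w
      · subst huw
        simp only [if_true, hfw, huv, if_false]
        decide
      have : ¬ EdgeIncident f u := fun hu =>
        (edgeIncident_eq_or_eq hu hv hfw hvw).elim huv huw
      simp [huv, huw, this]
    · intro i; simp [h3, (b1 i).symm]
    · intro i; simp [h4, (b2 i).symm]
    · intro i; simp [h5, (b4 i).symm]
    · rw [← h6]
      apply columnSum_congr
      intro k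
      simp [(b3 k).symm]

/-- A horizontal connection carries a closed chain with odd flux through the left boundary. -/
lemma exists_chain_of_horizConn {n : ℕ} {τ : EdgeConfig n} {b : Bool} (h : HorizConn τ b ∅) :
    ∃ c : Edge n → ZMod 2, (∀ f, c f ≠ 0 → greenB τ f = b) ∧
      (∀ u, edgeFlux c u = 0) ∧ (∀ i, c (Edge.vert i 0) = 0) ∧
      (∀ i, c (Edge.vert i (Fin.last n)) = 0) ∧ columnSum c 0 (Fin.last n) = 1 := by
  classical
  obtain ⟨j, hj⟩ := h
  obtain ⟨v, hv⟩ := exists_edgeIncident (Edge.horiz (Fin.last n) j)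
  obtain ⟨c, h1, h2, h3, h4, h5, h6⟩ := exists_chain_of_leftConn hj v hv
  refine ⟨c + Pi.single (Edge.horiz (Fin.last n) j) 1, ?_, ?_, ?_, ?_, ?_⟩
  · intro d hd
    by_cases hdf : d = Edge.horiz (Fin.last n) j
    · exact hdf ▸ (goodEdge_of_leftConn hj).1
    · exact h1 d (by simpa [Pi.single_apply, hdf] using hd)
  · intro u
    rw [edgeFlux_add, h2, edgeFlux_single]
    have : EdgeIncident (Edge.horiz (Fin.last n) j) u ↔ u = v := by
      constructor
      · intro hu
        by_contra huv
        exact (edgeIncident_interior hu hv huv).2.2.2 j rfl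
      · rintro rfl; exact hv
    simp only [this]
    split_ifs <;> decide
  · intro i; simp [h3]
  · intro i; simp [h4]
  · rw [← h6]
    apply columnSum_congr
    intro k
    have := j.pos
    simp [Fin.ext_iff, this.ne]

/-- The function `h` takes the value `x` on both faces next to `e`. -/
def ConstAcross {n : ℕ} (h : LVertex n → ZMod 2) (x : ZMod 2) : Edge n → Prop
  | Edge.horiz k j => h (k, j.castSucc) = x ∧ h (k, j.succ) = x
  | Edge.vert i k => h (i.castSucc, k) = x ∧ h (i.succ, k) = x

/-- Horizontal and vertical connections of opposite colours exclude each other. -/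
lemma not_horizConn_and_vertConn {n : ℕ} {τ : EdgeConfig n} (hτ : IceRule τ) {b : Bool}
    (hh : HorizConn τ b ∅) (hv : HorizConn (transposeConfig τ) (!b) ∅) : False := by
  obtain ⟨c, h1, h2, h3, h4, h5⟩ := exists_chain_of_horizConn hh
  let h : LVertex n → ZMod 2 := fun u => columnSum c u.1 u.2
  have hdiff : ∀ e, c e = faceDiff h e := by
    intro e
    cases e with
    | horiz k j =>
      simp only [faceDiff, h, columnSum, Fin.partialSum_succ]
      rw [← add_assoc, CharTwo.add_self_eq_zero, zero_add]
    | vert i k => exact (columnSum_add_columnSum h2 h3 i k).symm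
  have hopp : ∀ e, greenB τ e = (!b) → faceDiff h e = 0 := by
    intro e he
    rw [← hdiff]
    by_contra hne
    have := h1 e hne
    rw [he] at this
    cases b <;> exact absurd this (by decide)
  have hstep : ∀ e f v, EdgeIncident e v → EdgeIncident f v → greenB τ e = (!b) →
      greenB τ f = (!b) → ConstAcross h 0 e → ConstAcross h 0 f := by
    rintro e f ⟨i, j⟩ he hf hge hgf hce
    have hice := inDegree_eq_two_iff.1 (hτ i j)
    have o1 := hopp (leftE i j)
    have o2 := hopp (rightE i j)
    have o3 := hopp (botE i j)
    have o4 := hopp (topE i j)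
    rw [edgeIncident_iff] at he hf
    simp only [leftE, rightE, botE, topE, faceDiff, CharTwo.add_eq_zero] at *
    rcases he with rfl | rfl | rfl | rfl <;> rcases hf with rfl | rfl | rfl | rfl <;>
      simp only [ConstAcross] at hce ⊢ <;> grind
  obtain ⟨i', i, hg, hr⟩ := hv
  have hbase : ConstAcross h 0 (Edge.horiz (0 : Fin (n + 1)) i).swap := by
    simp [Edge.swap, ConstAcross, h, columnSum]
  have hend : ∀ e, Relation.ReflTransGen (Hop (transposeConfig τ) (!b) ∅) (Edge.horiz 0 i) e →
      ConstAcross h 0 e.swap := by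
    intro e he
    induction he with
    | refl => exact hbase
    | tail _ hhop ih =>
      obtain ⟨⟨v, hev, hfv⟩, he, hf⟩ := hhop
      exact hstep _ _ _ (edgeIncident_swap hev) (edgeIncident_swap hfv)
        ((greenB_transposeConfig _ _).symm.trans he.1)
        ((greenB_transposeConfig _ _).symm.trans hf.1) ih
  have hlast := (hend _ hr).1
  simp only [h] at hlast
  rw [columnSum_last_eq h2 h3 h4, h5] at hlast
  exact absurd hlast (by decide)

/-- Related elements are joined by a self-avoiding chain. -/
lemma exists_nodup_isChain {α : Type*} {r : α → α → Prop} {a b : α}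
    (h : Relation.ReflTransGen r a b) :
    ∃ l : List α, l.Nodup ∧ l.IsChain r ∧ l.head? = some a ∧ l.getLast? = some b := by
  induction h using Relation.ReflTransGen.head_induction_on with
  | refl => exact ⟨[b], by simp⟩
  | @head a c hac _ ih =>
    obtain ⟨l, hn, hl, hh, hlast⟩ := ih
    by_cases ha : a ∈ l
    · obtain ⟨s, t, rfl⟩ := List.append_of_mem ha
      refine ⟨a :: t, (List.nodup_append.1 hn).2.1, (List.isChain_append.1 hl).2.1, rfl, ?_⟩
      rw [← hlast]; simp [List.getLast?_cons]
    · obtain ⟨d, t, rfl⟩ : ∃ d t, l = d :: t := by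
        cases l with
        | nil => simp at hh
        | cons d t => exact ⟨d, t, rfl⟩
      obtain rfl : d = c := by simpa using hh
      exact ⟨a :: d :: t, List.nodup_cons.2 ⟨ha, hn⟩, List.isChain_cons_cons.2 ⟨hac, hl⟩, rfl,
        by simpa using hlast⟩

lemma reflTransGen_of_isChain {α : Type*} {r : α → α → Prop} {a b : α} {l : List α}
    (hl : l.IsChain r) (ha : l.head? = some a) (hb : l.getLast? = some b) :
    Relation.ReflTransGen r a b := by
  have hne : l ≠ [] := by rintro rfl; simp at ha
  have := List.relationReflTransGen_of_exists_isChain l hl hne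
  rw [List.head?_eq_some_head hne] at ha
  rw [List.getLast?_eq_some_getLast hne] at hb
  rwa [Option.some.inj ha, Option.some.inj hb] at this

lemma exists_monoPath_iff {n : ℕ} {τ : EdgeConfig n} {b : Bool} {e f : Edge n} :
    (∃ p, MonoPath τ b p ∧ p.head? = some e ∧ p.getLast? = some f) ↔
      greenB τ e = b ∧ Relation.ReflTransGen (Hop τ b ∅) e f := by
  constructor
  · rintro ⟨p, ⟨hne, hnd, hch, hcol⟩, he, hf⟩
    refine ⟨hcol e (List.mem_of_head? he), reflTransGen_of_isChain ?_ he hf⟩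
    refine List.IsChain.imp_of_mem_imp ?_ hch
    rintro x y hx hy ⟨-, hv⟩
    exact ⟨hv, ⟨hcol x hx, id⟩, hcol y hy, id⟩
  · rintro ⟨he, hr⟩
    have hr' : Relation.ReflTransGen (fun x y => x ≠ y ∧ Hop τ b ∅ x y) e f := by
      induction hr with
      | refl => rfl
      | @tail x y _ hxy ih =>
        by_cases hne : x = y
        · exact hne ▸ ih
        · exact ih.tail ⟨hne, hxy⟩
    obtain ⟨l, hn, hl, hh, hlast⟩ := exists_nodup_isChain hr'
    have hne : l ≠ [] := by rintro rfl; simp at hh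
    refine ⟨l, ⟨hne, hn, hl.imp fun x y h => ⟨h.1, h.2.1⟩, ?_⟩, hh, hlast⟩
    refine List.IsChain.induction (fun x => greenB τ x = b) l hl (fun x y h _ => h.2.2.2.1) ?_
    intro hne
    rw [List.head?_eq_some_head hne] at hh
    rw [Option.some.inj hh]
    exact he

lemma exists_isHorizBridge_iff {n : ℕ} {τ : EdgeConfig n} {b : Bool} :
    (∃ p, IsHorizBridge τ b p) ↔ HorizConn τ b ∅ := by
  constructor
  · rintro ⟨p, hp, ⟨j, hj⟩, j', hj'⟩
    obtain ⟨h1, h2⟩ := exists_monoPath_iff.1 ⟨p, hp, hj, hj'⟩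
    exact ⟨j', j, ⟨h1, id⟩, h2⟩
  · rintro ⟨j', j, h1, h2⟩
    obtain ⟨p, hp, hj, hj'⟩ := exists_monoPath_iff.2 ⟨h1.1, h2⟩
    exact ⟨p, hp, ⟨j, hj⟩, j', hj'⟩

lemma hop_transposeConfig {n : ℕ} {τ : EdgeConfig n} {b : Bool} {e f : Edge n}
    (h : Hop τ b ∅ e f) : Hop (transposeConfig τ) b ∅ e.swap f.swap := by
  obtain ⟨⟨v, he, hf⟩, h1, h2⟩ := h
  refine ⟨⟨v.swap, edgeIncident_swap he, edgeIncident_swap hf⟩, ⟨?_, id⟩, ?_, id⟩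
  · rw [greenB_transposeConfig, Edge.swap_swap, h1.1]
  · rw [greenB_transposeConfig, Edge.swap_swap, h2.1]

lemma exists_isVertBridge_iff {n : ℕ} {τ : EdgeConfig n} {b : Bool} :
    (∃ p, IsVertBridge τ b p) ↔ HorizConn (transposeConfig τ) b ∅ := by
  have hlast : ∀ {σ : EdgeConfig n} {e f}, greenB σ e = b →
      Relation.ReflTransGen (Hop σ b ∅) e f → greenB σ f = b := by
    intro σ e f he hr
    rcases Relation.ReflTransGen.cases_tail hr with rfl | ⟨g, -, hf⟩
    exacts [he, hf.2.2.1]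
  constructor
  · rintro ⟨p, hp, ⟨i, hi⟩, i', hi'⟩
    obtain ⟨h1, h2⟩ := exists_monoPath_iff.1 ⟨p, hp, hi, hi'⟩
    have h3 := reflTransGen_symm (fun _ _ => hop_symm) h2
    refine ⟨i, i', ⟨?_, id⟩, Relation.ReflTransGen.lift Edge.swap
      (fun _ _ => hop_transposeConfig) _ _ h3⟩
    rw [greenB_transposeConfig]
    exact hlast h1 h2
  · rintro ⟨i, i', h1, h2⟩
    have h3 := reflTransGen_symm (fun _ _ => hop_symm) h2
    have h4 := Relation.ReflTransGen.lift Edge.swap (fun _ _ => hop_transposeConfig) _ _ h3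
    rw [transposeConfig_transposeConfig] at h4
    have h5 := hlast h1.1 h2
    rw [greenB_transposeConfig] at h5
    obtain ⟨p, hp, hi, hi'⟩ := exists_monoPath_iff.2 ⟨h5, h4⟩
    exact ⟨p, hp, ⟨i, hi⟩, i', hi'⟩

lemma lStep_symm {n : ℕ} {τ : EdgeConfig n} {u v : LVertex n} (h : LStep τ u v) : LStep τ v u := by
  obtain ⟨e, he, ht⟩ := h
  exact ⟨e, he.symm, ht⟩

lemma lStep_of_transposeConfig {n : ℕ} {τ : EdgeConfig n} {u v : LVertex n}
    (h : LStep (transposeConfig τ) u v) : LStep τ u.swap v.swap := by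
  obtain ⟨⟨⟨i, j⟩, b⟩, he, ht⟩ := h
  refine ⟨((j, i), b), ?_, ?_⟩
  · obtain ⟨u1, u2⟩ := u
    obtain ⟨v1, v2⟩ := v
    cases b <;> simp only [StepOnEdge, lEdgeEnds, Prod.swap, Prod.mk.injEq] at he ⊢ <;> tauto
  · cases b <;> simp only [lTau, greenB_transposeConfig] at ht ⊢
    · change ((greenB τ (botE j i) == greenB τ (leftE j i)) &&
        (greenB τ (topE j i) == greenB τ (rightE j i)) &&
        !(greenB τ (botE j i) == greenB τ (topE j i))) = true at ht
      grind
    · change ((greenB τ (botE j i) == greenB τ (rightE j i)) &&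
        (greenB τ (topE j i) == greenB τ (leftE j i)) &&
        !(greenB τ (botE j i) == greenB τ (topE j i))) = true at ht
      grind

lemma hasVertFaultLine_of_reflTransGen {n : ℕ} {τ : EdgeConfig n} {u v : LVertex n}
    (hu : u.2 = Fin.last n) (hv : v.2 = 0) (h : Relation.ReflTransGen (LStep τ) u v) :
    HasVertFaultLine τ := by
  obtain ⟨l, hn, hl, hh, hlast⟩ := exists_nodup_isChain h
  exact ⟨l, by rintro rfl; simp at hh, hn, hl, ⟨u, hh, hu⟩, v, hlast, hv⟩

lemma hasHorizFaultLine_of_transposeConfig {n : ℕ} {τ : EdgeConfig n}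
    (h : HasVertFaultLine (transposeConfig τ)) : HasHorizFaultLine τ := by
  obtain ⟨p, -, -, hp, ⟨u, hu, hu2⟩, v, hv, hv2⟩ := h
  have h1 := reflTransGen_symm (fun _ _ => lStep_symm) (reflTransGen_of_isChain hp hu hv)
  have h2 := Relation.ReflTransGen.lift Prod.swap (fun _ _ => lStep_of_transposeConfig) _ _ h1
  obtain ⟨l, hn, hl, hh, hlast⟩ := exists_nodup_isChain h2
  exact ⟨l, by rintro rfl; simp at hh, hn, hl, ⟨_, hh, hv2⟩, _, hlast, hu2⟩

/-- A set of faces closed under `L_τ`-steps that contains the top and misses the bottom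
forces a monochromatic horizontal connection. -/
lemma exists_horizConn_of_closed {n : ℕ} {τ : EdgeConfig n} (hτ : IceRule τ) (W : Set (Edge n))
    (R : Set (LVertex n)) (htop : ∀ k, (k, Fin.last n) ∈ R) (hbot : ∀ k, (k, 0) ∉ R)
    (hL : ∀ u v, LStep τ u v → u ∈ R → v ∈ R)
    (hW : ∀ e ∈ W, faceDiff (R.indicator 1) e = 0) : ∃ b, HorizConn τ b W := by
  classical
  refine exists_horizConn hτ W (R.indicator 1) 0 (by simp [htop]) (by simp [hbot]) ?_ hW
  intro e he
  have h : (lEdgeEnds e).1 ∈ R ↔ (lEdgeEnds e).2 ∈ R :=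
    ⟨hL _ _ ⟨e, Or.inl rfl, he⟩, hL _ _ ⟨e, Or.inr rfl, he⟩⟩
  simp only [Set.indicator_apply, h, Pi.one_apply]

/-- The faces joined to the top by `L_τ`-steps. -/
def topReach {n : ℕ} (τ : EdgeConfig n) : Set (LVertex n) :=
  {v | ∃ u : LVertex n, u.2 = Fin.last n ∧ Relation.ReflTransGen (LStep τ) u v}

lemma horizConn_of_not_hasVertFaultLine {n : ℕ} {τ : EdgeConfig n} (hτ : IceRule τ)
    (h : ¬ HasVertFaultLine τ) : ∃ b, HorizConn τ b ∅ := by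
  refine exists_horizConn_of_closed hτ ∅ (topReach τ) (fun k => ⟨_, rfl, .refl⟩) ?_ ?_ (by simp)
  · rintro k ⟨u, hu, hr⟩
    exact h (hasVertFaultLine_of_reflTransGen hu rfl hr)
  · rintro v w hvw ⟨u, hu, hr⟩
    exact ⟨u, hu, hr.tail hvw⟩

lemma pathSteps_append {α : Type*} {r : α → α → Prop} {x y : α} {q : List α}
    (hq : (y :: q).IsChain r) (p : List α) (hp : p.IsChain r) (hx : p.getLast? = some x) :
    (x, y) ∈ pathSteps (p ++ y :: q) ∧
      ∀ t ∈ pathSteps (p ++ y :: q), t = (x, y) ∨ r t.1 t.2 := by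
  have hzip : ∀ l : List α, l.IsChain r → ∀ t ∈ pathSteps l, r t.1 t.2 := by
    intro l hl
    induction hl with
    | nil => simp [pathSteps]
    | singleton => simp [pathSteps]
    | cons_cons hab _ ih =>
      intro t ht
      rcases List.mem_cons.1 ht with rfl | ht
      exacts [hab, ih t ht]
  induction hp with
  | nil => simp at hx
  | singleton a =>
    obtain rfl : a = x := by simpa using hx
    refine ⟨List.mem_cons_self, fun t ht => ?_⟩
    exact (List.mem_cons.1 ht).imp id (hzip _ hq t)
  | cons_cons hab _ ih =>
    obtain ⟨h1, h2⟩ := ih (by simpa using hx)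
    refine ⟨List.mem_cons_of_mem _ h1, fun t ht => ?_⟩
    rcases List.mem_cons.1 ht with rfl | ht
    exacts [Or.inr hab, h2 t ht]

lemma lAdjacent_of_lStep {n : ℕ} {τ : EdgeConfig n} {u v : LVertex n} (h : LStep τ u v) :
    LAdjacent u v := by
  obtain ⟨e, he, -⟩ := h
  exact ⟨e, he⟩

/-- Bridging two disjoint parts of a potential fault line gives an almost fault line. -/
lemma exists_isVertAlmostFaultLine {n : ℕ} {τ : EdgeConfig n} (hFL : ¬ HasVertFaultLine τ)
    {x y w : LVertex n} (hx : x ∈ topReach τ) (hxy : LAdjacent x y)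
    (hyw : Relation.ReflTransGen (LStep τ) y w) (hw : w.2 = 0) :
    ∃ p, IsVertAlmostFaultLine τ p := by
  obtain ⟨u, hu, hux⟩ := hx
  obtain ⟨p, hpn, hp, hph, hpl⟩ := exists_nodup_isChain hux
  obtain ⟨q, hqn, hq, hqh, hql⟩ := exists_nodup_isChain hyw
  have hpath : ∀ {l : List (LVertex n)}, l.IsChain (LStep τ) → l.IsChain LAdjacent :=
    fun hl => hl.imp fun _ _ => lAdjacent_of_lStep
  have hjoin : ∀ z, z ∈ p → z ∈ q → False := by
    intro z hzp hzq
    obtain ⟨s, t, rfl⟩ := List.append_of_mem hzp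
    obtain ⟨s', t', rfl⟩ := List.append_of_mem hzq
    have h1 : Relation.ReflTransGen (LStep τ) u z :=
      reflTransGen_of_isChain (List.isChain_split.1 hp).1 (by cases s <;> simpa using hph) (by simp)
    have h2 : Relation.ReflTransGen (LStep τ) z w :=
      reflTransGen_of_isChain (List.isChain_split.1 hq).2 rfl (by simpa using hql)
    exact hFL (hasVertFaultLine_of_reflTransGen hu hw (h1.trans h2))
  cases q with
  | nil => simp at hqh
  | cons d q =>
    obtain rfl : d = y := by simpa using hqh
    obtain ⟨h1, h2⟩ := pathSteps_append hq p hp hpl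
    refine ⟨p ++ d :: q, by simp, ?_, ?_, ⟨u, ?_, hu⟩, ⟨w, ?_, hw⟩, (x, d), h1, ?_, ?_⟩
    · exact List.nodup_append.2 ⟨hpn, hqn, fun a ha b hb hab => hjoin a ha (hab ▸ hb)⟩
    · refine List.isChain_append.2 ⟨hpath hp, hpath hq, ?_⟩
      intro a ha b hb
      rw [hpl] at ha
      rw [hqh] at hb
      cases ha; cases hb
      exact hxy
    · simp [List.head?_append, hph]
    · simpa [List.getLast?_append] using hql
    · intro hs
      exact hFL (hasVertFaultLine_of_reflTransGen hu hw ((hux.tail hs).trans hyw))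
    · intro t ht hne
      exact (h2 t ht).resolve_left hne

/-- If crossing `W` amounts to jumping between a face `c` isolated in `L_τ` and its four
neighbours, then the absence of monochromatic connections avoiding `W` gives an almost
fault line. -/
lemma exists_isVertAlmostFaultLine_of_blocked {n : ℕ} {τ : EdgeConfig n} (hτ : IceRule τ)
    (W : Set (Edge n)) {c N S E O : LVertex n} (hc : c.2 ≠ Fin.last n) (hc' : c.2 ≠ 0)
    (hiso : ∀ u, ¬ LStep τ c u)
    (hadj : ∀ a ∈ ({N, S} : Set (LVertex n)), ∀ b ∈ ({E, O} : Set (LVertex n)),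
      LAdjacent a b ∧ LAdjacent b a)
    (hmix : ∃ a ∈ ({N, S} : Set (LVertex n)), ∃ b ∈ ({E, O} : Set (LVertex n)), LStep τ a b)
    (hW : ∀ h : LVertex n → ZMod 2, h N = h c → h S = h c → h E = h c → h O = h c →
      ∀ e ∈ W, faceDiff h e = 0)
    (hno : ∀ b, ¬ HorizConn τ b W) (hFL : ¬ HasVertFaultLine τ) :
    ∃ p, IsVertAlmostFaultLine τ p := by
  classical
  by_contra hAFL
  have hstep : ∀ x y w, x ∈ topReach τ → Relation.ReflTransGen (LStep τ) y w → w.2 = 0 →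
      ¬ LAdjacent x y :=
    fun x y w hx hyw hw hxy => hAFL (exists_isVertAlmostFaultLine hFL hx hxy hyw hw)
  have hsame : ∀ x w, x ∈ topReach τ → Relation.ReflTransGen (LStep τ) x w → w.2 ≠ 0 := by
    rintro x w ⟨u, hu, hux⟩ hxw hw
    exact hFL (hasVertFaultLine_of_reflTransGen hu hw (hux.trans hxw))
  have htail : ∀ u v, LStep τ u v → u ∈ topReach τ → v ∈ topReach τ := by
    rintro u v huv ⟨t, ht, htu⟩
    exact ⟨t, ht, htu.tail huv⟩
  have hctop : c ∉ topReach τ := by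
    rintro ⟨u, hu, huc⟩
    rcases Relation.ReflTransGen.cases_tail huc with rfl | ⟨d, -, hd⟩
    · exact hc hu
    · exact hiso _ (lStep_symm hd)
  have hcbot : ∀ w, Relation.ReflTransGen (LStep τ) c w → w.2 ≠ 0 := by
    intro w hw
    rcases Relation.ReflTransGen.cases_head hw with rfl | ⟨d, hd, -⟩
    · exact hc'
    · exact absurd hd (hiso _)
  let X : Set (LVertex n) := {c, N, S, E, O}
  by_cases hX : ∃ x ∈ X, x ∈ topReach τ
  · obtain ⟨x, hxX, hx⟩ := hX
    let R : Set (LVertex n) :=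
      topReach τ ∪ {u | ∃ y ∈ X, Relation.ReflTransGen (LStep τ) y u}
    have hXR : ∀ y ∈ X, y ∈ R := fun y hy => Or.inr ⟨y, hy, .refl⟩
    by_cases hb : ∃ k, ((k, 0) : LVertex n) ∈ R
    · obtain ⟨k, hk | ⟨y, hyX, hy⟩⟩ := hb
      · exact hsame _ _ hk .refl rfl
      · have hy2 := hcbot (k, 0)
        have hxy : x ≠ y := by rintro rfl; exact hsame _ _ hx hy rfl
        have h3 := hstep x y _ hx hy rfl
        obtain ⟨a, ha, b, hb, hab⟩ := hmix
        have hba := lStep_symm hab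
        have k1 : ∀ z, LStep τ x z → ¬ LAdjacent z y :=
          fun z hz => hstep z y _ (htail _ _ hz hx) hy rfl
        have k2 : ∀ z, LStep τ z y → ¬ LAdjacent x z :=
          fun z hz => hstep x z _ hx (hy.head hz) rfl
        have hxc : x ≠ c := by rintro rfl; exact hctop hx
        have hyc : y ≠ c := by rintro rfl; exact hy2 hy rfl
        have hxX' : x ∈ ({N, S} : Set (LVertex n)) ∨ x ∈ ({E, O} : Set (LVertex n)) := by
          simp only [X, Set.mem_insert_iff, Set.mem_singleton_iff] at hxX ⊢; tauto
        have hyX' : y ∈ ({N, S} : Set (LVertex n)) ∨ y ∈ ({E, O} : Set (LVertex n)) := by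
          simp only [X, Set.mem_insert_iff, Set.mem_singleton_iff] at hyX ⊢; tauto
        have two : ∀ {p q : LVertex n} {x y z : LVertex n}, x ∈ ({p, q} : Set (LVertex n)) →
            y ∈ ({p, q} : Set (LVertex n)) → z ∈ ({p, q} : Set (LVertex n)) → x ≠ y →
            z = x ∨ z = y := by
          simp only [Set.mem_insert_iff, Set.mem_singleton_iff]
          grind
        rcases hxX' with hx' | hx' <;> rcases hyX' with hy' | hy'
        · rcases two hx' hy' ha hxy with rfl | rfl
          · exact k1 b hab (hadj _ hy' _ hb).2
          · exact k2 b hba (hadj _ hx' _ hb).1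
        · exact h3 (hadj _ hx' _ hy').1
        · exact h3 (hadj _ hy' _ hx').2
        · rcases two hx' hy' hb hxy with rfl | rfl
          · exact k1 a hba (hadj _ ha _ hy').1
          · exact k2 a hab (hadj _ ha _ hx').2
    · push Not at hb
      obtain ⟨b, hb⟩ := exists_horizConn_of_closed hτ W R (fun k => Or.inl ⟨_, rfl, .refl⟩) hb
        (by
          rintro u v huv (hu | ⟨y, hy, hyu⟩)
          · exact Or.inl (htail _ _ huv hu)
          · exact Or.inr ⟨y, hy, hyu.tail huv⟩)
        (by
          have h1 : ∀ y ∈ X, R.indicator (1 : LVertex n → ZMod 2) y = 1 :=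
            fun y hy => Set.indicator_of_mem (hXR y hy) _
          apply hW <;> rw [h1 _ (by simp [X]), h1 _ (by simp [X])])
      exact hno b hb
  · push Not at hX
    obtain ⟨b, hb⟩ := exists_horizConn_of_closed hτ W (topReach τ) (fun k => ⟨_, rfl, .refl⟩)
      (fun k hk => hsame _ _ hk .refl rfl) htail
      (by
        have h1 : ∀ y ∈ X, (topReach τ).indicator (1 : LVertex n → ZMod 2) y = 0 :=
          fun y hy => Set.indicator_of_notMem (hX y hy) _
        apply hW <;> rw [h1 _ (by simp [X]), h1 _ (by simp [X])])
    exact hno b hb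

/-- The edges of the unit square with lower-left corner `(i, j)`. -/
def squareSet (n i j : ℕ) (hi : i + 1 < n) (hj : j + 1 < n) : Set (Edge n) :=
  {f | f = (squareEdges n i j hi hj).1 ∨ f = (squareEdges n i j hi hj).2.1 ∨
    f = (squareEdges n i j hi hj).2.2.1 ∨ f = (squareEdges n i j hi hj).2.2.2}

section Square

variable {n i j : ℕ} {hi : i + 1 < n} {hj : j + 1 < n}

lemma horiz_mem_squareSet {k : Fin (n + 1)} {l : Fin n} :
    Edge.horiz k l ∈ squareSet n i j hi hj ↔
      k.val = i + 1 ∧ (l.val = j ∨ l.val = j + 1) := by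
  simp [squareSet, squareEdges, Fin.ext_iff]
  tauto

lemma vert_mem_squareSet {l : Fin n} {k : Fin (n + 1)} :
    Edge.vert l k ∈ squareSet n i j hi hj ↔
      k.val = j + 1 ∧ (l.val = i ∨ l.val = i + 1) := by
  simp [squareSet, squareEdges, Fin.ext_iff]
  tauto

lemma greenB_flipSquare_of_mem {τ : EdgeConfig n} {e : Edge n}
    (he : e ∈ squareSet n i j hi hj) :
    greenB (flipSquare τ (squareEdges n i j hi hj)) e = !greenB τ e := by
  have : flipSquare τ (squareEdges n i j hi hj) e = !τ e := if_pos he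
  rw [greenB, greenB, this]
  cases τ e <;> cases greenOrient e <;> rfl

lemma greenB_flipSquare_of_notMem {τ : EdgeConfig n} {e : Edge n}
    (he : e ∉ squareSet n i j hi hj) :
    greenB (flipSquare τ (squareEdges n i j hi hj)) e = greenB τ e := by
  have : flipSquare τ (squareEdges n i j hi hj) e = τ e := if_neg he
  rw [greenB, greenB, this]

/-- A directed square is monochromatic. -/
lemma exists_greenB_eq_of_directedSquare {τ : EdgeConfig n}
    (h : DirectedSquare τ (squareEdges n i j hi hj)) :
    ∃ s, ∀ e ∈ squareSet n i j hi hj, greenB τ e = s := by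
  have h1 : (i + 1 + (j + 1)) % 2 = (i + j) % 2 := by omega
  have h2 : (i + (j + 1)) % 2 = (i + 1 + j) % 2 := by omega
  have h3 : (i + j) % 2 = 0 ∧ (i + 1 + j) % 2 = 1 ∨ (i + j) % 2 = 1 ∧ (i + 1 + j) % 2 = 0 := by
    omega
  simp only [DirectedSquare, squareEdges] at h
  simp only [squareSet, squareEdges, Set.mem_ofPred_eq, forall_eq_or_imp, forall_eq, greenB,
    greenOrient, h1, h2]
  rcases h with ⟨a, b, c, d⟩ | ⟨a, b, c, d⟩ <;> rcases h3 with ⟨p, q⟩ | ⟨p, q⟩ <;>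
    rw [a, b, c, d, p, q] <;> decide

/-- Flipping a directed square preserves the ice rule. -/
lemma iceRule_flipSquare {τ : EdgeConfig n} (hτ : IceRule τ)
    (h : DirectedSquare τ (squareEdges n i j hi hj)) :
    IceRule (flipSquare τ (squareEdges n i j hi hj)) := by
  classical
  obtain ⟨s, hs⟩ := exists_greenB_eq_of_directedSquare h
  intro a b
  have hice := inDegree_eq_two_iff.1 (hτ a b)
  rw [inDegree_eq_two_iff]
  have hflip : ∀ e, greenB (flipSquare τ (squareEdges n i j hi hj)) e =
      if e ∈ squareSet n i j hi hj then !greenB τ e else greenB τ e := by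
    intro e
    split_ifs with he
    exacts [greenB_flipSquare_of_mem he, greenB_flipSquare_of_notMem he]
  have m1 : leftE a b ∈ squareSet n i j hi hj ↔ a.val = i + 1 ∧ (b.val = j ∨ b.val = j + 1) :=
    horiz_mem_squareSet
  have m2 : rightE a b ∈ squareSet n i j hi hj ↔ a.val = i ∧ (b.val = j ∨ b.val = j + 1) := by
    simp [rightE, horiz_mem_squareSet]
  have m3 : botE a b ∈ squareSet n i j hi hj ↔ b.val = j + 1 ∧ (a.val = i ∨ a.val = i + 1) :=
    vert_mem_squareSet
  have m4 : topE a b ∈ squareSet n i j hi hj ↔ b.val = j ∧ (a.val = i ∨ a.val = i + 1) := by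
    simp [topE, vert_mem_squareSet]
  have s1 := hs (leftE a b)
  have s2 := hs (rightE a b)
  have s3 := hs (botE a b)
  have s4 := hs (topE a b)
  simp only [hflip]
  rw [m1] at s1 ⊢
  rw [m2] at s2 ⊢
  rw [m3] at s3 ⊢
  rw [m4] at s4 ⊢
  clear hflip m1 m2 m3 m4
  by_cases hb : b.val = j ∨ b.val = j + 1
  · by_cases ha : a.val = i ∨ a.val = i + 1
    · rcases ha with ha | ha <;> rcases hb with hb | hb <;>
        simp [ha, hb] at s1 s2 s3 s4 ⊢ <;> grind
    · push Not at ha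
      simpa [ha] using hice
  · push Not at hb
    simpa [hb] using hice

variable {τ : EdgeConfig n}

/-- The centre of a red square is isolated in `L_τ`. -/
lemma not_lStep_centre (hred : ∀ e ∈ squareSet n i j hi hj, greenB τ e = false)
    (u : LVertex n) :
    ¬ LStep τ (⟨i + 1, by omega⟩, ⟨j + 1, by omega⟩) u := by
  rintro ⟨⟨⟨a, b⟩, t⟩, he, ht⟩
  have r1 := hred (leftE a b)
  have r2 := hred (rightE a b)
  have r3 := hred (botE a b)
  have r4 := hred (topE a b)
  simp only [leftE, rightE, botE, topE, horiz_mem_squareSet, vert_mem_squareSet,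
    Fin.val_succ, Fin.val_castSucc] at r1 r2 r3 r4
  obtain ⟨u1, u2⟩ := u
  cases t <;> simp only [StepOnEdge, lEdgeEnds, Prod.mk.injEq, Fin.ext_iff, Fin.val_succ,
    Fin.val_castSucc] at he <;>
    simp only [lTau, leftE, rightE, botE, topE] at ht <;>
    rcases he with ⟨⟨h1, h2⟩, -⟩ | ⟨-, h1, h2⟩ <;> grind

/-- If no corner of a red square is crossed by `L_τ` alongside the square, then every edge
touching the square is red. -/
lemma red_of_forall_not_lStep (hτ : IceRule τ)
    (hred : ∀ e ∈ squareSet n i j hi hj, greenB τ e = false)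
    (hno : ∀ a ∈ ({(⟨i + 1, by omega⟩, ⟨j + 2, by omega⟩), (⟨i + 1, by omega⟩, ⟨j, by omega⟩)} :
      Set (LVertex n)), ∀ b ∈ ({(⟨i + 2, by omega⟩, ⟨j + 1, by omega⟩),
        (⟨i, by omega⟩, ⟨j + 1, by omega⟩)} : Set (LVertex n)), ¬ LStep τ a b)
    {e f : Edge n} {v : Fin n × Fin n} (he : e ∈ squareSet n i j hi hj)
    (hev : EdgeIncident e v) (hfv : EdgeIncident f v) : greenB τ f = false := by
  obtain ⟨a, b⟩ := v
  have hab : (a.val = i ∨ a.val = i + 1) ∧ (b.val = j ∨ b.val = j + 1) := by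
    rcases edgeIncident_iff.1 hev with rfl | rfl | rfl | rfl <;>
      simp only [leftE, rightE, botE, topE, horiz_mem_squareSet, vert_mem_squareSet,
        Fin.val_succ, Fin.val_castSucc] at he <;> omega
  have hice := inDegree_eq_two_iff.1 (hτ a b)
  have r1 := hred (leftE a b)
  have r2 := hred (rightE a b)
  have r3 := hred (botE a b)
  have r4 := hred (topE a b)
  have m1 : leftE a b ∈ squareSet n i j hi hj ↔ a.val = i + 1 ∧ (b.val = j ∨ b.val = j + 1) :=
    horiz_mem_squareSet
  have m2 : rightE a b ∈ squareSet n i j hi hj ↔ a.val = i ∧ (b.val = j ∨ b.val = j + 1) := by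
    simp [rightE, horiz_mem_squareSet]
  have m3 : botE a b ∈ squareSet n i j hi hj ↔ b.val = j + 1 ∧ (a.val = i ∨ a.val = i + 1) :=
    vert_mem_squareSet
  have m4 : topE a b ∈ squareSet n i j hi hj ↔ b.val = j ∧ (a.val = i ∨ a.val = i + 1) := by
    simp [topE, vert_mem_squareSet]
  rw [m1] at r1
  rw [m2] at r2
  rw [m3] at r3
  rw [m4] at r4
  have hl : ∀ t, (∃ p ∈ ({(⟨i + 1, by omega⟩, ⟨j + 2, by omega⟩),
      (⟨i + 1, by omega⟩, ⟨j, by omega⟩)} : Set (LVertex n)),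
      ∃ q ∈ ({(⟨i + 2, by omega⟩, ⟨j + 1, by omega⟩), (⟨i, by omega⟩, ⟨j + 1, by omega⟩)} :
        Set (LVertex n)), StepOnEdge ((a, b), t) p q) → ¬ lTau τ ((a, b), t) = true := by
    rintro t ⟨p, hp, q, hq, hpq⟩ ht
    exact hno p hp q hq ⟨_, hpq, ht⟩
  have l1 := hl true
  have l2 := hl false
  clear hl
  simp only [Set.mem_insert_iff, Set.mem_singleton_iff, exists_eq_or_imp, exists_eq_left,
    StepOnEdge, lEdgeEnds, Prod.mk.injEq, Fin.ext_iff, Fin.val_succ, Fin.val_castSucc, lTau]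
    at l1 l2
  clear hno hred m1 m2 m3 m4
  rcases hab with ⟨ha | ha, hb | hb⟩ <;> simp [ha, hb] at r1 r2 r3 r4 l1 l2 <;>
    rcases edgeIncident_iff.1 hfv with rfl | rfl | rfl | rfl <;> grind

lemma lAdjacent_neighbours (a : LVertex n)
    (ha : a ∈ ({(⟨i + 1, by omega⟩, ⟨j + 2, by omega⟩), (⟨i + 1, by omega⟩, ⟨j, by omega⟩)} :
      Set (LVertex n))) (b : LVertex n)
    (hb : b ∈ ({(⟨i + 2, by omega⟩, ⟨j + 1, by omega⟩), (⟨i, by omega⟩, ⟨j + 1, by omega⟩)} :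
      Set (LVertex n))) : LAdjacent a b ∧ LAdjacent b a := by
  have key : LAdjacent a b := by
    rcases ha with rfl | rfl <;> rcases hb with rfl | rfl
    · exact ⟨((⟨i + 1, hi⟩, ⟨j + 1, hj⟩), false), Or.inr rfl⟩
    · exact ⟨((⟨i, by omega⟩, ⟨j + 1, hj⟩), true), Or.inr rfl⟩
    · exact ⟨((⟨i + 1, hi⟩, ⟨j, by omega⟩), true), Or.inl rfl⟩
    · exact ⟨((⟨i, by omega⟩, ⟨j, by omega⟩), false), Or.inl rfl⟩
  obtain ⟨e, he⟩ := key
  exact ⟨⟨e, he⟩, e, he.symm⟩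

lemma faceDiff_eq_zero_of_mem_squareSet (h : LVertex n → ZMod 2) {x : ZMod 2}
    (hc : h (⟨i + 1, by omega⟩, ⟨j + 1, by omega⟩) = x)
    (hN : h (⟨i + 1, by omega⟩, ⟨j + 2, by omega⟩) = x)
    (hS : h (⟨i + 1, by omega⟩, ⟨j, by omega⟩) = x)
    (hE : h (⟨i + 2, by omega⟩, ⟨j + 1, by omega⟩) = x)
    (hO : h (⟨i, by omega⟩, ⟨j + 1, by omega⟩) = x) :
    ∀ e ∈ squareSet n i j hi hj, faceDiff h e = 0 := by
  rintro e (rfl | rfl | rfl | rfl) <;> simp only [squareEdges, faceDiff, CharTwo.add_eq_zero]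
  · exact hS.trans hc.symm
  · exact hc.trans hE.symm
  · exact hc.trans hN.symm
  · exact hO.trans hc.symm

end Square

lemma HorizConn.mono {n : ℕ} {σ τ : EdgeConfig n} {b : Bool} {W V : Set (Edge n)}
    (h : ∀ e, GoodEdge σ b W e → GoodEdge τ b V e) (hσ : HorizConn σ b W) : HorizConn τ b V := by
  obtain ⟨j, j', hj, hr⟩ := hσ
  exact ⟨j, j', h _ hj,
    Relation.ReflTransGen.mono (fun _ _ ⟨hv, he, hf⟩ => ⟨hv, h _ he, h _ hf⟩) _ _ hr⟩

lemma mem_CG_iff {n : ℕ} {τ : EdgeConfig n} : τ ∈ CG n ↔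
    IceRule τ ∧ HorizConn τ true ∅ ∧ HorizConn (transposeConfig τ) true ∅ := by
  rw [← exists_isHorizBridge_iff, ← exists_isVertBridge_iff]; rfl

lemma mem_CR_iff {n : ℕ} {τ : EdgeConfig n} : τ ∈ CR n ↔
    IceRule τ ∧ HorizConn τ false ∅ ∧ HorizConn (transposeConfig τ) false ∅ := by
  rw [← exists_isHorizBridge_iff, ← exists_isVertBridge_iff]; rfl

/-- A state without a fault line has a green cross or a red cross. -/
lemma mem_CG_or_mem_CR {n : ℕ} {τ : EdgeConfig n} (hτ : IceRule τ) (hFL : τ ∉ CFL n) :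
    τ ∈ CG n ∨ τ ∈ CR n := by
  obtain ⟨b, hb⟩ := horizConn_of_not_hasVertFaultLine hτ fun h => hFL ⟨hτ, Or.inr h⟩
  obtain ⟨d, hd⟩ := horizConn_of_not_hasVertFaultLine (iceRule_transposeConfig hτ)
    fun h => hFL ⟨hτ, Or.inl (hasHorizFaultLine_of_transposeConfig h)⟩
  rw [mem_CG_iff, mem_CR_iff]
  cases b <;> cases d
  · exact Or.inr ⟨hτ, hb, hd⟩
  · exact (not_horizConn_and_vertConn hτ hb hd).elim
  · exact (not_horizConn_and_vertConn hτ hb hd).elim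
  · exact Or.inl ⟨hτ, hb, hd⟩

/-- no single move of `M_G` connects `Ω_LEFT = C_G` to
`Ω_RIGHT = C_R \ C_AFL`: every transition of `M_G` from a state in `C_G`
leads to a state in `C_G ∪ C_FL ∪ (C_AFL ∩ C_R)`. -/
theorem no_move_from_left_to_right (n : ℕ) (hn : 1 ≤ n)
    (τ τ' : EdgeConfig n) (hτ : τ ∈ CG n) (hmove : GlauberMove τ τ') :
    τ' ∈ CG n ∪ CFL n ∪ (CAFL n ∩ CR n) := by
  obtain ⟨i, j, hi, hj, hdir, rfl⟩ := hmove
  set σ := flipSquare τ (squareEdges n i j hi hj) with hσ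
  obtain ⟨hice, hh, hv⟩ := mem_CG_iff.1 hτ
  have hσice : IceRule σ := iceRule_flipSquare hice hdir
  obtain ⟨s, hs⟩ := exists_greenB_eq_of_directedSquare hdir
  have hin : ∀ e ∈ squareSet n i j hi hj, greenB σ e = !s := fun e he => by
    rw [hσ, greenB_flipSquare_of_mem he, hs e he]
  have hout : ∀ e, e ∉ squareSet n i j hi hj → greenB σ e = greenB τ e :=
    fun e he => greenB_flipSquare_of_notMem he
  by_cases hFL : σ ∈ CFL n
  · exact Or.inl (Or.inr hFL)
  rcases mem_CG_or_mem_CR hσice hFL with hG | hR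
  · exact Or.inl (Or.inl hG)
  refine Or.inr ⟨⟨hσice, Or.inr ?_⟩, hR⟩
  obtain ⟨-, -, hRv⟩ := mem_CR_iff.1 hR
  have hnoG : ¬ HorizConn σ true ∅ := fun h => not_horizConn_and_vertConn hσice h hRv
  have hnoR : ¬ HorizConn τ false ∅ := fun h => not_horizConn_and_vertConn hice h hv
  obtain rfl : s = true := by
    by_contra hne
    rw [Bool.not_eq_true] at hne
    subst hne
    refine hnoG (hh.mono fun e he => ⟨?_, id⟩)
    by_cases hes : e ∈ squareSet n i j hi hj
    · exact hin e hes
    · exact (hout e hes).trans he.1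
  refine exists_isVertAlmostFaultLine_of_blocked hσice (squareSet n i j hi hj)
    (c := (⟨i + 1, by omega⟩, ⟨j + 1, by omega⟩)) (N := (⟨i + 1, by omega⟩, ⟨j + 2, by omega⟩))
    (S := (⟨i + 1, by omega⟩, ⟨j, by omega⟩)) (E := (⟨i + 2, by omega⟩, ⟨j + 1, by omega⟩))
    (O := (⟨i, by omega⟩, ⟨j + 1, by omega⟩)) ?_ ?_ (not_lStep_centre hin)
    (lAdjacent_neighbours (hi := hi) (hj := hj)) ?_
    (fun h hN hS hE hO => faceDiff_eq_zero_of_mem_squareSet h rfl hN hS hE hO) ?_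
    fun h => hFL ⟨hσice, Or.inr h⟩
  · simp only [ne_eq, Fin.ext_iff, Fin.val_last]; omega
  · simp only [ne_eq, Fin.ext_iff, Fin.val_zero]; omega
  · by_contra! hno
    have hred : ∀ {e f : Edge n} {v}, e ∈ squareSet n i j hi hj → EdgeIncident e v →
        EdgeIncident f v → greenB σ f = false := red_of_forall_not_lStep hσice hin hno
    obtain ⟨k, l, hl, hr⟩ := hh
    have key : ∀ e, Relation.ReflTransGen (Hop τ true ∅) (Edge.horiz 0 l) e →
        LeftConn σ true ∅ e ∧ e ∉ squareSet n i j hi hj := by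
      intro e he
      induction he with
      | refl =>
        have hmem : Edge.horiz 0 l ∉ squareSet n i j hi hj := by simp [horiz_mem_squareSet]
        exact ⟨⟨l, ⟨(hout _ hmem).trans hl.1, id⟩, .refl⟩, hmem⟩
      | @tail e f _ hhop ih =>
        obtain ⟨⟨v, hev, hfv⟩, -, hf⟩ := hhop
        obtain ⟨hconn, hes⟩ := ih
        have hge := goodEdge_of_leftConn hconn
        have hfs : f ∉ squareSet n i j hi hj := by
          intro hfs
          have := hred hfs hfv hev
          rw [hge.1] at this
          exact absurd this (by decide)
        obtain ⟨m, hm, hmr⟩ := hconn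
        exact ⟨⟨m, hm, hmr.tail ⟨⟨v, hev, hfv⟩, hge, (hout f hfs).trans hf.1, id⟩⟩, hfs⟩
    exact hnoG ⟨k, (key _ hr).1⟩
  · rintro (_ | _) hb
    · exact hnoR (hb.mono fun e he => ⟨(hout e he.2).symm.trans he.1, id⟩)
    · exact hnoG (hb.mono fun e he => ⟨he.1, id⟩)
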